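/- Let R be an integral domain. Then R is a PvMD if and only if for every w-finitely generated R-module M, the canonical short exact sequence 0 → T(M) → M →π→ M/T(M) → 0 (where T(M) is the torsion submodule) w-splits: there exists a GV-ideal J such that for every d ∈ J there is an R-homomorphism h : M/T(M) → M with π ∘ h = d·id. -/

import Mathlib

open TensorProduct

/-- A finitely generated ideal `J` is a GV-ideal if the natural map
`R → Hom_R(J, R)`, sending `r` to multiplication by `r`, is bijective. -/
def IsGVIdeal {R : Type*} [CommRing R] (J : Ideal R) : Prop :=
  J.FG ∧ Function.Bijective fun r : R => (r • J.subtype : J →ₗ[R] R)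

/-- An element `m` of an `R`-module is a GV-torsion element if it is
annihilated by some GV-ideal. -/
def IsGVTorsionElem (R : Type*) [CommRing R] {M : Type*} [AddCommGroup M] [Module R M]
    (m : M) : Prop :=
  ∃ J : Ideal R, IsGVIdeal J ∧ ∀ j ∈ J, j • m = 0

/-- An `R`-module `M` is `w`-finitely generated if it has a finitely generated
submodule `N` such that `M/N` is GV-torsion. -/
def IsWFinitelyGenerated (R : Type*) [CommRing R] (M : Type*) [AddCommGroup M]
    [Module R M] : Prop :=
  ∃ N : Submodule R M, N.FG ∧ ∀ x : M ⧸ N, IsGVTorsionElem R x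

/-- `R` is a PvMD if for every nonzero finitely generated ideal `I` of `R` there is a
GV-ideal `J` with `J ⊆ I·I⁻¹` (inside the quotient field `K`). -/
def IsPvMD (R : Type*) [CommRing R] [IsDomain R] (K : Type*) [Field K] [Algebra R K]
    [IsFractionRing R K] : Prop :=
  ∀ I : Ideal R, I ≠ ⊥ → I.FG →
    ∃ J : Ideal R, IsGVIdeal J ∧
      (J : FractionalIdeal (nonZeroDivisors R) K) ≤
        (I : FractionalIdeal (nonZeroDivisors R) K) *
          (I : FractionalIdeal (nonZeroDivisors R) K)⁻¹

namespace IsGVIdeal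

variable {R : Type*} [CommRing R]

lemma exists_eq_mul {J : Ideal R} (hJ : IsGVIdeal J) (φ : J →ₗ[R] R) :
    ∃ r : R, ∀ j : J, φ j = r * j := by
  obtain ⟨r, hr⟩ := hJ.2.2 φ
  exact ⟨r, fun j => by simp [← hr]⟩

lemma exists_ne_zero [Nontrivial R] {J : Ideal R} (hJ : IsGVIdeal J) : ∃ j ∈ J, j ≠ 0 := by
  by_contra! h
  refine zero_ne_one (α := R) (hJ.2.1 (LinearMap.ext fun j => ?_))
  simp [h j j.2]

lemma of_exists_eq_mul [IsDomain R] {J : Ideal R} (hfg : J.FG) (hne : ∃ j ∈ J, j ≠ 0)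
    (h : ∀ φ : J →ₗ[R] R, ∃ r : R, ∀ j : J, φ j = r * j) : IsGVIdeal J := by
  refine ⟨hfg, fun a b hab => ?_, fun φ => ?_⟩
  · obtain ⟨j, hj, hj0⟩ := hne
    exact mul_right_cancel₀ hj0 (by simpa using LinearMap.congr_fun hab ⟨j, hj⟩)
  · obtain ⟨r, hr⟩ := h φ
    exact ⟨r, LinearMap.ext fun j => by simp [hr]⟩

lemma top [IsDomain R] : IsGVIdeal (⊤ : Ideal R) := by
  refine of_exists_eq_mul ⟨{1}, by simp⟩ ⟨1, trivial, one_ne_zero⟩ fun φ => ⟨φ ⟨1, trivial⟩, ?_⟩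
  rintro ⟨j, hj⟩
  have : (⟨j, hj⟩ : (⊤ : Ideal R)) = j • ⟨1, trivial⟩ := Subtype.ext (by simp)
  rw [this, map_smul]
  simp [mul_comm]

lemma mul [IsDomain R] {I J : Ideal R} (hI : IsGVIdeal I) (hJ : IsGVIdeal J) :
    IsGVIdeal (I * J) := by
  obtain ⟨b, hb, hb0⟩ := hJ.exists_ne_zero
  obtain ⟨a, ha, ha0⟩ := hI.exists_ne_zero
  refine of_exists_eq_mul (hI.1.mul hJ.1) ⟨a * b, Ideal.mul_mem_mul ha hb, mul_ne_zero ha0 hb0⟩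
    fun φ => ?_
  have inner : ∀ i : I, ∃ r : R, ∀ j : J, φ ⟨i * j, Ideal.mul_mem_mul i.2 j.2⟩ = r * j := by
    intro i
    refine hJ.exists_eq_mul (φ ∘ₗ LinearMap.codRestrict (I * J)
      ((LinearMap.mulLeft R (i : R)) ∘ₗ J.subtype) fun j => Ideal.mul_mem_mul i.2 j.2)
  choose r hr using inner
  obtain ⟨s, hs⟩ := hI.exists_eq_mul
    { toFun := r
      map_add' := fun x y => by
        refine mul_right_cancel₀ hb0 ?_
        rw [add_mul, ← hr x ⟨b, hb⟩, ← hr y ⟨b, hb⟩, ← hr (x + y) ⟨b, hb⟩, ← map_add]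
        congr 1
        exact Subtype.ext (by simp [add_mul])
      map_smul' := fun c x => by
        refine mul_right_cancel₀ hb0 ?_
        rw [RingHom.id_apply, smul_eq_mul, mul_assoc, ← hr x ⟨b, hb⟩, ← hr (c • x) ⟨b, hb⟩,
          ← smul_eq_mul c (φ _), ← map_smul]
        congr 1
        exact Subtype.ext (by simp [mul_assoc]) }
  refine ⟨s, ?_⟩
  rintro ⟨x, hx⟩
  refine Submodule.mul_induction_on' (C := fun x hx => φ ⟨x, hx⟩ = s * x) ?_ ?_ hx
  · intro i hi j hj
    have h1 := hr ⟨i, hi⟩ ⟨j, hj⟩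
    have h2 : r ⟨i, hi⟩ = s * i := hs ⟨i, hi⟩
    rw [h2] at h1
    rw [← mul_assoc]
    exact h1
  · intro x hx y hy h1 h2
    rw [mul_add, ← h1, ← h2, ← map_add]
    rfl

/-- If, up to a GV-ideal depending on `d`, each element `d` of a GV-ideal lies in `A`, then `A`
contains a GV-ideal. -/
lemma exists_le_of_forall_mul_mem [IsDomain R] {A J : Ideal R} (hJ : IsGVIdeal J)
    (h : ∀ d ∈ J, ∃ L : Ideal R, IsGVIdeal L ∧ ∀ e ∈ L, e * d ∈ A) :
    ∃ L : Ideal R, IsGVIdeal L ∧ L ≤ A := by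
  have key : ∀ B : Ideal R, B.FG → B ≤ J → ∃ L : Ideal R, IsGVIdeal L ∧ L * B ≤ A := by
    intro B hB
    induction B, hB using Submodule.fg_induction with
    | singleton x =>
      intro hx
      obtain ⟨L, hL, hLA⟩ := h x (hx (Submodule.mem_span_singleton_self x))
      refine ⟨L, hL, Ideal.mul_le.2 fun e he y hy => ?_⟩
      obtain ⟨c, rfl⟩ := Submodule.mem_span_singleton.1 hy
      rw [smul_eq_mul, mul_left_comm]
      exact A.mul_mem_left c (hLA e he)
    | sup B₁ B₂ _ _ ih₁ ih₂ =>
      intro hB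
      obtain ⟨L₁, hL₁, h₁⟩ := ih₁ (le_sup_left.trans hB)
      obtain ⟨L₂, hL₂, h₂⟩ := ih₂ (le_sup_right.trans hB)
      refine ⟨L₁ * L₂, hL₁.mul hL₂, ?_⟩
      rw [Ideal.mul_sup]
      exact sup_le ((Ideal.mul_mono_left Ideal.mul_le_left).trans h₁)
        ((Ideal.mul_mono_left Ideal.mul_le_right).trans h₂)
  obtain ⟨L, hL, hLA⟩ := key J hJ.1 le_rfl
  exact ⟨L * J, hL.mul hJ, hLA⟩

end IsGVIdeal

/-- The linear maps that factor through a finite free module. -/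
def finiteFreeMaps (R M N : Type*) [CommRing R] [AddCommGroup M] [Module R M]
    [AddCommGroup N] [Module R N] : Submodule R (M →ₗ[R] N) :=
  Submodule.span R (Set.range fun p : (M →ₗ[R] R) × N => p.1.smulRight p.2)

section finiteFreeMaps

variable {R M N P : Type*} [CommRing R] [AddCommGroup M] [Module R M] [AddCommGroup N]
  [Module R N] [AddCommGroup P] [Module R P]

lemma smulRight_mem_finiteFreeMaps (f : M →ₗ[R] R) (x : N) :
    f.smulRight x ∈ finiteFreeMaps R M N :=
  Submodule.subset_span ⟨(f, x), rfl⟩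

lemma finiteFreeMaps_induction {C : (M →ₗ[R] N) → Prop}
    (smulRight : ∀ (f : M →ₗ[R] R) (x : N), C (f.smulRight x)) (zero : C 0)
    (add : ∀ u v, C u → C v → C (u + v)) {u : M →ₗ[R] N} (hu : u ∈ finiteFreeMaps R M N) :
    C u := by
  have smul : ∀ (c : R) (p : (M →ₗ[R] R) × N), C (c • p.1.smulRight p.2) := fun c p => by
    have : c • p.1.smulRight p.2 = (c • p.1).smulRight p.2 :=
      LinearMap.ext fun y => by simp [mul_smul]
    rw [this]
    exact smulRight _ _
  have key : ∀ c : R, C (c • u) := by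
    induction hu using Submodule.span_induction with
    | mem u hu =>
      obtain ⟨p, rfl⟩ := hu
      exact fun c => smul c p
    | zero => simpa using zero
    | add u v _ _ hu hv => exact fun c => smul_add c u v ▸ add _ _ (hu c) (hv c)
    | smul a u _ hu => exact fun c => smul_smul c a u ▸ hu (c * a)
  simpa using key 1

lemma comp_mem_finiteFreeMaps (v : N →ₗ[R] P) {u : M →ₗ[R] N} (hu : u ∈ finiteFreeMaps R M N) :
    v ∘ₗ u ∈ finiteFreeMaps R M P := by
  refine finiteFreeMaps_induction (C := fun u => v ∘ₗ u ∈ finiteFreeMaps R M P)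
    (fun f x => ?_) (by simp) (fun u w hu hw => ?_) hu
  · convert smulRight_mem_finiteFreeMaps f (v x)
    ext y
    simp
  · rw [LinearMap.comp_add]
    exact add_mem hu hw

lemma mem_finiteFreeMaps_comp {u : N →ₗ[R] P} (hu : u ∈ finiteFreeMaps R N P) (v : M →ₗ[R] N) :
    u ∘ₗ v ∈ finiteFreeMaps R M P := by
  refine finiteFreeMaps_induction (C := fun u => u ∘ₗ v ∈ finiteFreeMaps R M P)
    (fun f x => ?_) (by simp) (fun u w hu hw => ?_) hu
  · exact smulRight_mem_finiteFreeMaps (f ∘ₗ v) x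
  · rw [LinearMap.add_comp]
    exact add_mem hu hw

lemma exists_lift_of_mem_finiteFreeMaps {g : N →ₗ[R] P} (hg : Function.Surjective g)
    {u : M →ₗ[R] P} (hu : u ∈ finiteFreeMaps R M P) :
    ∃ v ∈ finiteFreeMaps R M N, g ∘ₗ v = u := by
  refine finiteFreeMaps_induction (C := fun u => ∃ v ∈ finiteFreeMaps R M N, g ∘ₗ v = u)
    (fun f x => ?_) ⟨0, zero_mem _, by simp⟩ ?_ hu
  · obtain ⟨y, rfl⟩ := hg x
    exact ⟨f.smulRight y, smulRight_mem_finiteFreeMaps f y, by ext z; simp⟩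
  · rintro _ _ ⟨u, hu, rfl⟩ ⟨v, hv, rfl⟩
    exact ⟨u + v, add_mem hu hv, LinearMap.comp_add _ _ _⟩

end finiteFreeMaps

section Extension

variable {R P : Type*} [CommRing R] [AddCommGroup P] [Module R P]
  {N : Submodule R P}

lemma exists_isGVIdeal_smul_mem (hN : ∀ x : P ⧸ N, IsGVTorsionElem R x) (x : P) :
    ∃ J : Ideal R, IsGVIdeal J ∧ ∀ j ∈ J, j • x ∈ N := by
  obtain ⟨J, hJ, h⟩ := hN (N.mkQ x)
  refine ⟨J, hJ, fun j hj => ?_⟩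
  simpa [← Submodule.Quotient.mk_smul, Submodule.Quotient.mk_eq_zero] using h j hj

lemma exists_ne_zero_smul_mem [Nontrivial R] (hN : ∀ x : P ⧸ N, IsGVTorsionElem R x) (x : P) :
    ∃ c : R, c ≠ 0 ∧ c • x ∈ N := by
  obtain ⟨J, hJ, h⟩ := exists_isGVIdeal_smul_mem hN x
  obtain ⟨c, hc, hc0⟩ := hJ.exists_ne_zero
  exact ⟨c, hc0, h c hc⟩

lemma exists_functional_extension [IsDomain R] (hN : ∀ x : P ⧸ N, IsGVTorsionElem R x) (f : N →ₗ[R] R) :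
    ∃ F : P →ₗ[R] R, F ∘ₗ N.subtype = f := by
  have key : ∀ x : P, ∃ r : R, ∀ (c : R) (y : N), (y : P) = c • x → f y = c * r := by
    intro x
    obtain ⟨J, hJ, h⟩ := exists_isGVIdeal_smul_mem hN x
    obtain ⟨r, hr⟩ := hJ.exists_eq_mul (f ∘ₗ LinearMap.codRestrict N
      ((LinearMap.toSpanSingleton R P x) ∘ₗ J.subtype) fun j => h j j.2)
    obtain ⟨b, hb, hb0⟩ := hJ.exists_ne_zero
    refine ⟨r, fun c y hy => mul_left_cancel₀ hb0 ?_⟩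
    have h1 : f ⟨b • x, h b hb⟩ = r * b := hr ⟨b, hb⟩
    have h2 : b • y = c • (⟨b • x, h b hb⟩ : N) := Subtype.ext (by simp [hy, smul_comm b c])
    rw [← smul_eq_mul, ← map_smul, h2, map_smul, h1, smul_eq_mul]
    ring
  choose r hr using key
  refine ⟨{ toFun := r, map_add' := fun x y => ?_, map_smul' := fun c x => ?_ },
    LinearMap.ext fun y => ?_⟩
  · obtain ⟨a, ha0, ha⟩ := exists_ne_zero_smul_mem hN x
    obtain ⟨b, hb0, hb⟩ := exists_ne_zero_smul_mem hN y
    refine mul_left_cancel₀ (mul_ne_zero hb0 ha0) ?_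
    have hx : (b * a) • x ∈ N := by rw [mul_smul]; exact N.smul_mem b ha
    have hy : (b * a) • y ∈ N := by rw [mul_comm, mul_smul]; exact N.smul_mem a hb
    rw [mul_add, ← hr x (b * a) ⟨_, hx⟩ rfl, ← hr y (b * a) ⟨_, hy⟩ rfl, ← map_add]
    exact (hr (x + y) (b * a) _ (by simp)).symm
  · obtain ⟨a, ha0, ha⟩ := exists_ne_zero_smul_mem hN x
    refine mul_left_cancel₀ ha0 ?_
    rw [RingHom.id_apply, smul_eq_mul, mul_left_comm, ← hr x a ⟨_, ha⟩ rfl, ← smul_eq_mul c,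
      ← map_smul]
    exact (hr (c • x) a _ (by simp [smul_comm a c])).symm
  · simpa using (hr y 1 y (by simp)).symm

lemma exists_finiteFreeMaps_extension [IsDomain R]
    (hN : ∀ x : P ⧸ N, IsGVTorsionElem R x) {u : N →ₗ[R] N}
    (hu : u ∈ finiteFreeMaps R N N) :
    ∃ v ∈ finiteFreeMaps R P P, v ∘ₗ N.subtype = N.subtype ∘ₗ u := by
  refine finiteFreeMaps_induction
    (C := fun u => ∃ v ∈ finiteFreeMaps R P P, v ∘ₗ N.subtype = N.subtype ∘ₗ u)
    (fun f x => ?_) ⟨0, zero_mem _, by simp⟩ ?_ hu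
  · obtain ⟨F, rfl⟩ := exists_functional_extension hN f
    exact ⟨F.smulRight x, smulRight_mem_finiteFreeMaps F _, by ext; simp⟩
  · rintro u₁ u₂ ⟨v₁, hv₁, h₁⟩ ⟨v₂, hv₂, h₂⟩
    exact ⟨v₁ + v₂, add_mem hv₁ hv₂, by rw [LinearMap.add_comp, h₁, h₂, LinearMap.comp_add]⟩

/-- Multiplication by a scalar factors through a finite free module on a torsion-free module as
soon as it does so on a submodule with GV-torsion quotient. -/
lemma smul_id_mem_finiteFreeMaps_of_submodule [IsDomain R] [Module.IsTorsionFree R P]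
    (hN : ∀ x : P ⧸ N, IsGVTorsionElem R x) {d : R}
    (hd : d • LinearMap.id ∈ finiteFreeMaps R N N) :
    d • LinearMap.id ∈ finiteFreeMaps R P P := by
  obtain ⟨v, hv, hvN⟩ := exists_finiteFreeMaps_extension hN hd
  convert hv
  ext x
  obtain ⟨c, hc0, hc⟩ := exists_ne_zero_smul_mem hN x
  have := LinearMap.congr_fun hvN ⟨c • x, hc⟩
  refine smul_right_injective P hc0 ?_
  simpa [smul_comm c d] using this.symm

end Extension

lemma Module.Finite.exists_injective_pi {R N : Type*} [CommRing R] [IsDomain R] [AddCommGroup N]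
    [Module R N] [Module.Finite R N] [Module.IsTorsionFree R N] :
    ∃ (n : ℕ) (e : N →ₗ[R] (Fin n → R)), Function.Injective e := by
  obtain ⟨m, s, hs⟩ := Module.Finite.exists_fin (R := R) (M := N)
  obtain ⟨I, hli, hI⟩ := exists_maximal_linearIndepOn R s
  have hli' : LinearIndependent R fun i : I => s i := hli
  have exists_a : ∀ i, ∃ a : R, a ≠ 0 ∧
      a • s i ∈ Submodule.span R (Set.range fun i : I => s i) := by
    intro i
    by_cases hi : i ∈ I
    · exact ⟨1, one_ne_zero, by rw [one_smul]; exact Submodule.subset_span ⟨⟨i, hi⟩, rfl⟩⟩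
    · simpa [Set.image_eq_range s I] using! hI i hi
  choose a ha ha' using exists_a
  have hA : ∏ i, a i ≠ 0 := Finset.prod_ne_zero_iff.2 fun i _ => ha i
  have hmem : ∀ x : N, (∏ i, a i) • x ∈ Submodule.span R (Set.range fun i : I => s i) := by
    intro x
    have hx : x ∈ Submodule.span R (Set.range s) := hs ▸ trivial
    induction hx using Submodule.span_induction with
    | mem x hx =>
      obtain ⟨i, rfl⟩ := hx
      rw [← Finset.prod_erase_mul _ _ (Finset.mem_univ i), mul_smul]
      exact Submodule.smul_mem _ _ (ha' i)
    | zero => simp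
    | add x y _ _ hx hy => rw [smul_add]; exact add_mem hx hy
    | smul c x _ hx => rw [smul_comm]; exact Submodule.smul_mem _ _ hx
  let b := (Module.Basis.span hli').reindex (Finite.equivFin I)
  refine ⟨_, b.equivFun.toLinearMap ∘ₗ
    LinearMap.codRestrict _ (LinearMap.lsmul R N (∏ i, a i)) hmem, ?_⟩
  refine b.equivFun.injective.comp fun x y hxy => ?_
  exact smul_right_injective N hA (congrArg Subtype.val hxy)

/-- Over a PvMD, multiplication by the elements of a suitable GV-ideal on a finitely generated
ideal factors through a finite free module. -/
lemma IsPvMD.exists_ideal_smul_id_mem {R K : Type*} [CommRing R] [IsDomain R] [Field K]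
    [Algebra R K] [IsFractionRing R K] (h : IsPvMD R K) {I : Ideal R} (hI : I.FG) :
    ∃ J : Ideal R, IsGVIdeal J ∧ ∀ d ∈ J, d • LinearMap.id ∈ finiteFreeMaps R I I := by
  rcases eq_or_ne I ⊥ with rfl | hI0
  · refine ⟨⊤, .top, fun d _ => ?_⟩
    rw [show d • LinearMap.id = 0 from LinearMap.ext fun x => Subsingleton.elim _ _]
    exact zero_mem _
  have hI0' : (I : FractionalIdeal (nonZeroDivisors R) K) ≠ 0 :=
    FractionalIdeal.coeIdeal_ne_zero.2 hI0
  obtain ⟨J, hJ, hJI⟩ := h I hI0 hI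
  refine ⟨J, hJ, fun d hd => ?_⟩
  suffices ∃ u ∈ finiteFreeMaps R I I, ∀ x : I,
      algebraMap R K (u x) = algebraMap R K d * algebraMap R K x by
    obtain ⟨u, hu, hux⟩ := this
    convert hu
    ext x
    apply IsFractionRing.injective R K
    simp [hux]
  refine FractionalIdeal.mul_induction_on (C := fun z => ∃ u ∈ finiteFreeMaps R I I, ∀ x : I,
      algebraMap R K (u x) = z * algebraMap R K x)
    (hJI (FractionalIdeal.mem_coeIdeal_of_mem _ hd)) ?_ ?_
  · intro y hy q hq
    obtain ⟨a, ha, rfl⟩ := (FractionalIdeal.mem_coeIdeal _).1 hy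
    rw [FractionalIdeal.mem_inv_iff hI0'] at hq
    have hq' : ∀ x : I, ∃ r : R, algebraMap R K r = q * algebraMap R K x := fun x =>
      (FractionalIdeal.mem_one_iff _).1 (hq _ (FractionalIdeal.mem_coeIdeal_of_mem _ x.2))
    choose r hr using hq'
    let f : I →ₗ[R] R :=
      { toFun := r
        map_add' := fun x y => IsFractionRing.injective R K (by simp [hr, mul_add])
        map_smul' := fun c x => IsFractionRing.injective R K (by
          simp [hr, mul_left_comm]) }
    refine ⟨f.smulRight ⟨a, ha⟩, smulRight_mem_finiteFreeMaps f _, fun x => ?_⟩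
    have hfx : algebraMap R K (f x) = q * algebraMap R K x := hr x
    simp only [LinearMap.smulRight_apply, Submodule.coe_smul, smul_eq_mul, map_mul, hfx]
    ring
  · rintro x y ⟨u, hu, hux⟩ ⟨v, hv, hvy⟩
    exact ⟨u + v, add_mem hu hv, fun z => by simp [hux, hvy, add_mul]⟩

/-- A finitely generated torsion-free module over a PvMD is `w`-projective. -/
lemma IsPvMD.exists_smul_id_mem_of_injective {R K : Type*} [CommRing R] [IsDomain R] [Field K]
    [Algebra R K] [IsFractionRing R K] (h : IsPvMD R K) (n : ℕ) :
    ∀ (N : Type*) [AddCommGroup N] [Module R N] [Module.Finite R N] (e : N →ₗ[R] (Fin n → R)),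
      Function.Injective e →
      ∃ J : Ideal R, IsGVIdeal J ∧ ∀ d ∈ J, d • LinearMap.id ∈ finiteFreeMaps R N N := by
  induction n with
  | zero =>
    intro N _ _ _ e he
    refine ⟨⊤, .top, fun d _ => ?_⟩
    have : Subsingleton N := he.subsingleton
    rw [show d • LinearMap.id = 0 from LinearMap.ext fun x => Subsingleton.elim _ _]
    exact zero_mem _
  | succ n ih =>
    intro N _ _ _ e he
    let tail : (Fin (n + 1) → R) →ₗ[R] (Fin n → R) := LinearMap.funLeft R R Fin.succ
    let f : N →ₗ[R] LinearMap.range (LinearMap.proj 0 ∘ₗ e) :=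
      (LinearMap.proj 0 ∘ₗ e).rangeRestrict
    have hf : Function.Surjective f := LinearMap.surjective_rangeRestrict _
    have hfe : ∀ x, (f x : R) = e x 0 := fun x => rfl
    have htail : ∀ x, f x = 0 → tail (e x) = 0 → x = 0 := by
      intro x h0 h1
      refine he ?_
      rw [map_zero]
      funext i
      refine Fin.cases ?_ (fun i => ?_) i
      · rw [← hfe, h0]; rfl
      · exact congrFun h1 i
    obtain ⟨J, hJ, hJI⟩ := h.exists_ideal_smul_id_mem
      (I := LinearMap.range (LinearMap.proj 0 ∘ₗ e))
      (Module.Finite.iff_fg.1 inferInstance)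
    let A : Ideal R := (finiteFreeMaps R N N).comap (LinearMap.toSpanSingleton R _ LinearMap.id)
    refine IsGVIdeal.exists_le_of_forall_mul_mem (A := A) hJ fun d hd => ?_
    obtain ⟨v, hv, hfv⟩ := exists_lift_of_mem_finiteFreeMaps hf (hJI d hd)
    let g : N →ₗ[R] N := d • LinearMap.id - v ∘ₗ f
    have hfg : ∀ x, f (g x) = 0 := by
      intro x
      have := LinearMap.congr_fun hfv (f x)
      simp only [LinearMap.comp_apply, LinearMap.smul_apply, LinearMap.id_apply] at this
      simp [g, this]
    obtain ⟨L, hL, hLg⟩ := ih (LinearMap.range g) (tail ∘ₗ e ∘ₗ (LinearMap.range g).subtype) (by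
      rw [← LinearMap.ker_eq_bot, LinearMap.ker_eq_bot']
      rintro ⟨_, x, rfl⟩ hx
      exact Subtype.ext (htail _ (hfg x) hx))
    refine ⟨L, hL, fun c hc => ?_⟩
    have hdecomp : (c * d) • LinearMap.id = c • (v ∘ₗ f) +
        (LinearMap.range g).subtype ∘ₗ (c • LinearMap.id) ∘ₗ g.rangeRestrict := by
      ext x
      simp [g, mul_smul, smul_sub]
    change (c * d) • LinearMap.id ∈ finiteFreeMaps R N N
    rw [hdecomp]
    exact add_mem (Submodule.smul_mem _ _ (mem_finiteFreeMaps_comp hv f))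
      (comp_mem_finiteFreeMaps _ (mem_finiteFreeMaps_comp (hLg c hc) _))

lemma IsWFinitelyGenerated.of_surjective {R M P : Type*} [CommRing R] [AddCommGroup M]
    [Module R M] [AddCommGroup P] [Module R P] (hM : IsWFinitelyGenerated R M)
    {g : M →ₗ[R] P} (hg : Function.Surjective g) : IsWFinitelyGenerated R P := by
  obtain ⟨N, hN, hNt⟩ := hM
  refine ⟨N.map g, hN.map g, fun x => ?_⟩
  obtain ⟨y, rfl⟩ := Submodule.mkQ_surjective _ x
  obtain ⟨z, rfl⟩ := hg y
  obtain ⟨J, hJ, hz⟩ := hNt (N.mkQ z)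
  refine ⟨J, hJ, fun j hj => ?_⟩
  have h1 := hz j hj
  rw [← map_smul, Submodule.mkQ_apply, Submodule.Quotient.mk_eq_zero] at h1
  rw [← map_smul, Submodule.mkQ_apply, Submodule.Quotient.mk_eq_zero, ← map_smul]
  exact Submodule.mem_map_of_mem h1

lemma isWFinitelyGenerated_of_finite (R M : Type*) [CommRing R] [IsDomain R] [AddCommGroup M]
    [Module R M] [Module.Finite R M] : IsWFinitelyGenerated R M :=
  ⟨⊤, Module.Finite.fg_top, fun _ => ⟨⊤, .top, fun _ _ => Subsingleton.elim _ _⟩⟩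

/-- If the canonical sequence of `F / c K₀` splits after multiplication by `d`, where `K₀` is the
kernel of a linear form `p` on `F` and `c` is a value of `p`, then `d` lies in the
product of the range of `p` and its inverse, as witnessed by `y / c`. -/
lemma exists_smul_dvd_of_splitting {R F : Type*} [CommRing R] [IsDomain R] [AddCommGroup F]
    [Module R F] (p : F →ₗ[R] R) {w : F} (hw : p w ≠ 0) {d : R}
    {B : Submodule R F} (hB : B = (LinearMap.ker p).map (LinearMap.lsmul R F (p w)))
    (h : ((F ⧸ B) ⧸ Submodule.torsion R (F ⧸ B)) →ₗ[R] F ⧸ B)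
    (hh : (Submodule.torsion R (F ⧸ B)).mkQ ∘ₗ h = d • LinearMap.id) :
    ∃ y : F, p y = d * p w ∧ ∀ v : F, ∃ z : F, p v • y = p w • z := by
  let H : F →ₗ[R] F ⧸ B := h ∘ₗ (Submodule.torsion R (F ⧸ B)).mkQ ∘ₗ B.mkQ
  have hBp : ∀ y ∈ B, p y = 0 := by
    rw [hB]
    rintro _ ⟨k, hk, rfl⟩
    have : p k = 0 := hk
    simp [this]
  have hker : ∀ y, p y = 0 → H y = 0 := by
    intro y hy
    have : B.mkQ y ∈ Submodule.torsion R (F ⧸ B) := by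
      refine (Submodule.mem_torsion_iff _).2 ⟨⟨p w, mem_nonZeroDivisors_of_ne_zero hw⟩, ?_⟩
      change p w • B.mkQ y = 0
      rw [← map_smul, Submodule.mkQ_apply, Submodule.Quotient.mk_eq_zero]
      exact hB ▸ ⟨y, hy, rfl⟩
    have h0 : (Submodule.torsion R (F ⧸ B)).mkQ (B.mkQ y) = 0 :=
      (Submodule.Quotient.mk_eq_zero _).2 this
    simp only [H, LinearMap.comp_apply, h0, map_zero]
  obtain ⟨y, hy⟩ := B.mkQ_surjective (H w)
  refine ⟨y, ?_, fun v => ?_⟩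
  · have h1 := LinearMap.congr_fun hh ((Submodule.torsion R (F ⧸ B)).mkQ (B.mkQ w))
    have h2 : (Submodule.torsion R (F ⧸ B)).mkQ (B.mkQ (y - d • w)) = 0 := by
      rw [map_sub, hy, map_sub, sub_eq_zero, map_smul, map_smul]
      exact h1
    obtain ⟨r, hr⟩ := (Submodule.mem_torsion_iff _).1 ((Submodule.Quotient.mk_eq_zero _).1 h2)
    replace hr : (r : R) • B.mkQ (y - d • w) = 0 := hr
    rw [← map_smul, Submodule.mkQ_apply, Submodule.Quotient.mk_eq_zero] at hr
    have h3 := hBp _ hr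
    rw [map_smul, smul_eq_mul, mul_eq_zero, map_sub, map_smul, sub_eq_zero] at h3
    exact h3.resolve_left (nonZeroDivisors.ne_zero r.2)
  · obtain ⟨z, hz⟩ := B.mkQ_surjective (H v)
    have h1 : H (p v • w - p w • v) = 0 := hker _ (by simp [mul_comm])
    have h2 : p v • y - p w • z ∈ B := by
      rw [← Submodule.Quotient.mk_eq_zero, ← Submodule.mkQ_apply, map_sub, map_smul, map_smul,
        hy, hz, ← h1, map_sub, map_smul, map_smul]
    rw [hB] at h2
    obtain ⟨k, -, hk⟩ := h2
    refine ⟨z + k, ?_⟩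
    rw [smul_add, ← sub_eq_iff_eq_add']
    exact hk.symm

/-- `R` is a PvMD iff for every `w`-finitely generated `R`-module `M`
the canonical exact sequence `0 → T(M) → M → M/T(M) → 0` w-splits. -/
theorem pvmd_iff_canonical_sequence_wsplits_of_wfg
    {R : Type u} [CommRing R] [IsDomain R] :
    IsPvMD R (FractionRing R) ↔
      ∀ (M : Type u) [AddCommGroup M] [Module R M], IsWFinitelyGenerated R M →
        ∃ J : Ideal R, IsGVIdeal J ∧
          ∀ d ∈ J, ∃ h : (M ⧸ Submodule.torsion R M) →ₗ[R] M,
            (Submodule.torsion R M).mkQ ∘ₗ h = d • LinearMap.id := by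
  constructor
  · intro h M _ _ hM
    obtain ⟨N, hN, hNt⟩ := hM.of_surjective (Submodule.mkQ_surjective (Submodule.torsion R M))
    have : Module.Finite R N := Module.Finite.iff_fg.2 hN
    obtain ⟨n, e, he⟩ := Module.Finite.exists_injective_pi (R := R) (N := N)
    obtain ⟨J, hJ, hd⟩ := h.exists_smul_id_mem_of_injective n N e he
    refine ⟨J, hJ, fun d hdJ => ?_⟩
    obtain ⟨v, -, hv⟩ := exists_lift_of_mem_finiteFreeMaps
      (Submodule.mkQ_surjective (Submodule.torsion R M))
      (smul_id_mem_finiteFreeMaps_of_submodule hNt (hd d hdJ))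
    exact ⟨v, hv⟩
  · intro h I hI0 hI
    set K := FractionRing R
    have hI0' : (I : FractionalIdeal (nonZeroDivisors R) K) ≠ 0 :=
      FractionalIdeal.coeIdeal_ne_zero.2 hI0
    obtain ⟨n, a, rfl⟩ := Submodule.fg_iff_exists_fin_generating_family.1 hI
    let p : (Fin n → R) →ₗ[R] R := Fintype.linearCombination R a
    have hp : LinearMap.range p = Submodule.span R (Set.range a) :=
      Fintype.range_linearCombination R a
    obtain ⟨c, hcI, hc0⟩ := Submodule.exists_mem_ne_zero_of_ne_bot hI0
    obtain ⟨w, rfl⟩ : c ∈ LinearMap.range p := hp ▸ hcI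
    obtain ⟨J, hJ, hd⟩ := h (_ ⧸ (LinearMap.ker p).map (LinearMap.lsmul R _ (p w)))
      (isWFinitelyGenerated_of_finite R _)
    refine ⟨J, hJ, fun z hz => ?_⟩
    obtain ⟨d, hdJ, rfl⟩ := (FractionalIdeal.mem_coeIdeal _).1 hz
    obtain ⟨t, ht⟩ := hd d hdJ
    obtain ⟨y, hy, hdvd⟩ := exists_smul_dvd_of_splitting p hc0 rfl t ht
    have hc0' : algebraMap R K (p w) ≠ 0 := by simpa using hc0
    have hpy : p y = ∑ i, y i * a i := by simp [p, Fintype.linearCombination_apply]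
    have hsum : algebraMap R K d =
        ∑ i, algebraMap R K (a i) * (algebraMap R K (y i) / algebraMap R K (p w)) := by
      rw [eq_comm, ← mul_left_inj' hc0', ← map_mul, ← hy, hpy, Finset.sum_mul, map_sum]
      refine Finset.sum_congr rfl fun i _ => ?_
      rw [map_mul, mul_assoc, div_mul_cancel₀ _ hc0', mul_comm]
    rw [hsum]
    refine Submodule.sum_mem (FractionalIdeal.coeToSubmodule _) fun i _ => ?_
    refine FractionalIdeal.mul_mem_mul
      (FractionalIdeal.mem_coeIdeal_of_mem _ (Submodule.subset_span ⟨i, rfl⟩)) ?_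
    rw [FractionalIdeal.mem_inv_iff hI0']
    intro x hx
    obtain ⟨x, hxI, rfl⟩ := (FractionalIdeal.mem_coeIdeal _).1 hx
    obtain ⟨v, rfl⟩ : x ∈ LinearMap.range p := hp ▸ hxI
    obtain ⟨s, hs⟩ := hdvd v
    refine (FractionalIdeal.mem_one_iff _).2 ⟨s i, ?_⟩
    have hsi := congrArg (algebraMap R K) (congrFun hs i)
    simp only [Pi.smul_apply, smul_eq_mul, map_mul] at hsi
    rw [div_mul_eq_mul_div, eq_div_iff hc0', mul_comm, ← hsi, mul_comm]
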